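/- arXiv:2204.05154 — 8 statements merged into one kernel-verified Lean document; each statement's English description precedes it below -/
import Mathlib

section
/- With the layered partition-matroid construction, a set S belongs to the family I of common independent sets if and only if there exists an index i ∈ {1,…,k} such that S contains no element of N_{i+1} ∪ ⋯ ∪ N_k, at most one element of N_i, and every element of S outside N_i belongs to {u_1,…,u_{i−1}}. -/
/-- Membership in the family `I` of common independent sets of the layered
partition-matroid construction: `S ⊆ N₁ ∪ ⋯ ∪ N_k` and, for every `i ∈ {1,…,k}`,
`|S ∩ (N_{≤i} \ {u₁,…,u_{i−1}})| ≤ 1`. -/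
def LayeredIndep {α : Type*} [DecidableEq α] (k : ℕ) (N : ℕ → Finset α) (u : ℕ → α)
    (S : Finset α) : Prop :=
  S ⊆ (Finset.Icc 1 k).biUnion N ∧
    ∀ i ∈ Finset.Icc 1 k,
      (S ∩ ((Finset.Icc 1 i).biUnion N \ (Finset.Icc 1 (i - 1)).image u)).card ≤ 1

/-- A set `S` belongs to the family `I` of common independent sets iff there is an index
`i ∈ {1,…,k}` such that `S` contains no element of `N_{i+1} ∪ ⋯ ∪ N_k`, at most one
element of `N_i`, and every element of `S` outside `N_i` belongs to `{u₁,…,u_{i−1}}`. -/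
theorem layeredIndep_iff {α : Type*} [DecidableEq α] (k m : ℕ) (hk : 1 ≤ k) (hm : 1 ≤ m)
    (N : ℕ → Finset α)
    (hdisj : ∀ i ∈ Finset.Icc 1 k, ∀ j ∈ Finset.Icc 1 k, i ≠ j → Disjoint (N i) (N j))
    (hcard : ∀ i ∈ Finset.Icc 1 k, (N i).card = m)
    (u : ℕ → α) (hu : ∀ i ∈ Finset.Icc 1 (k - 1), u i ∈ N i)
    (S : Finset α) :
    LayeredIndep k N u S ↔
      ∃ i ∈ Finset.Icc 1 k,
        (∀ j ∈ Finset.Icc (i + 1) k, S ∩ N j = ∅) ∧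
        (S ∩ N i).card ≤ 1 ∧
        S \ N i ⊆ (Finset.Icc 1 (i - 1)).image u := by
  have hmem_unique : ∀ {i j x}, 1 ≤ i → i ≤ k → 1 ≤ j → j ≤ k → x ∈ N i → x ∈ N j → i = j := by
    intro i j x hi hik hj hjk hxi hxj
    by_contra hne
    exact Finset.disjoint_left.mp
      (hdisj i (Finset.mem_Icc.2 ⟨hi, hik⟩) j (Finset.mem_Icc.2 ⟨hj, hjk⟩) hne) hxi hxj
  have hu' : ∀ {i}, 1 ≤ i → i ≤ k - 1 → u i ∈ N i := fun hi hik =>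
    hu _ (Finset.mem_Icc.2 ⟨hi, hik⟩)
  simp only [LayeredIndep, Finset.card_le_one, Finset.subset_iff, Finset.mem_inter,
    Finset.mem_sdiff, Finset.mem_biUnion, Finset.mem_image, Finset.mem_Icc,
    Finset.eq_empty_iff_forall_notMem]
  constructor
  · rintro ⟨hsub, hone⟩
    rcases S.eq_empty_or_nonempty with rfl | ⟨x₀, hx₀⟩
    · exact ⟨1, ⟨le_rfl, hk⟩, by simp⟩
    obtain ⟨i₀, hi₀, hxi₀⟩ := hsub hx₀
    -- the last layer that meets `S`
    obtain ⟨i, hi, hmax⟩ := ((Finset.Icc 1 k).filter fun i => ∃ x ∈ S, x ∈ N i).exists_max_image id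
      ⟨i₀, by simpa using ⟨hi₀, x₀, hx₀, hxi₀⟩⟩
    simp only [Finset.mem_filter, Finset.mem_Icc, id] at hi hmax
    obtain ⟨hik, y, hyS, hyi⟩ := hi
    have hlayer : ∀ x ∈ N i, (∃ a, (1 ≤ a ∧ a ≤ i) ∧ x ∈ N a) ∧
        ¬∃ a, (1 ≤ a ∧ a ≤ i - 1) ∧ u a = x := by
      refine fun x hx => ⟨⟨i, ⟨hik.1, le_rfl⟩, hx⟩, ?_⟩
      rintro ⟨a, ha, rfl⟩
      have := hmem_unique ha.1 (by omega) hik.1 hik.2 (hu' ha.1 (by omega)) hx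
      omega
    refine ⟨i, hik, ?_, ?_, ?_⟩
    · rintro j hj x ⟨hxS, hxj⟩
      have := hmax j ⟨⟨by omega, hj.2⟩, x, hxS, hxj⟩
      omega
    · rintro a ⟨haS, ha⟩ b ⟨hbS, hb⟩
      exact hone i hik a ⟨haS, hlayer a ha⟩ b ⟨hbS, hlayer b hb⟩
    · rintro x ⟨hxS, hxi⟩
      by_contra hxu
      obtain ⟨j, hj, hxj⟩ := hsub hxS
      have hji := hmax j ⟨hj, x, hxS, hxj⟩
      have hxy := hone i hik x ⟨hxS, ⟨j, ⟨hj.1, hji⟩, hxj⟩, hxu⟩ y ⟨hyS, hlayer y hyi⟩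
      exact hxi (hxy ▸ hyi)
  · rintro ⟨i, hi, -, hone, hout⟩
    refine ⟨fun x hxS => ?_, fun j hj => ?_⟩
    · by_cases hxi : x ∈ N i
      · exact ⟨i, hi, hxi⟩
      · obtain ⟨a, ha, rfl⟩ := hout ⟨hxS, hxi⟩
        exact ⟨a, ⟨ha.1, by omega⟩, hu' ha.1 (by omega)⟩
    · rcases le_or_gt i j with hij | hji
      · have hmem : ∀ x ∈ S, (¬∃ a, (1 ≤ a ∧ a ≤ j - 1) ∧ u a = x) → x ∈ N i := by
          intro x hxS hxu
          by_contra hxi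
          obtain ⟨a, ha, hax⟩ := hout ⟨hxS, hxi⟩
          exact hxu ⟨a, ⟨ha.1, by omega⟩, hax⟩
        rintro a ⟨haS, -, ha⟩ b ⟨hbS, -, hb⟩
        exact hone a ⟨haS, hmem a haS ha⟩ b ⟨hbS, hmem b hbS hb⟩
      · have heq : ∀ x ∈ S, (∃ a, (1 ≤ a ∧ a ≤ j) ∧ x ∈ N a) →
            (¬∃ a, (1 ≤ a ∧ a ≤ j - 1) ∧ u a = x) → x = u j := by
          rintro x hxS ⟨b, hb, hxb⟩ hxu
          have hxi : x ∉ N i := fun hxi => by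
            have := hmem_unique hb.1 (by omega) hi.1 hi.2 hxb hxi
            omega
          obtain ⟨a, ha, rfl⟩ := hout ⟨hxS, hxi⟩
          have hab := hmem_unique ha.1 (by omega) hb.1 (by omega) (hu' ha.1 (by omega)) hxb
          have haj : ¬a ≤ j - 1 := fun h => hxu ⟨a, ⟨ha.1, h⟩, rfl⟩
          rw [show a = j by omega]
        rintro a ⟨haS, haN, ha⟩ b ⟨hbS, hbN, hb⟩
        rw [heq a haS haN ha, heq b hbS hbN hb]
end

section
/- With the layered partition-matroid construction, every set S in the family I satisfies |S| ≤ k, and a set S ∈ I has |S| = k if and only if S = {u_1,…,u_{k−1}} ∪ {e} for some element e ∈ N_k. -/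
theorem injOn_of_mem_pairwise_disjoint {ι α : Type*} {s : Set ι} {N : ι → Finset α} {u : ι → α}
    (hdisj : ∀ i ∈ s, ∀ j ∈ s, i ≠ j → Disjoint (N i) (N j)) (hu : ∀ i ∈ s, u i ∈ N i) :
    Set.InjOn u s := by
  intro i hi j hj hij
  by_contra hne
  exact Finset.disjoint_left.1 (hdisj i hi j hj hne) (hu i hi) (hij ▸ hu j hj)

/-- Every `S ∈ I` satisfies `|S| ≤ k`, and `S ∈ I` has `|S| = k` iff
`S = {u₁,…,u_{k−1}} ∪ {e}` for some `e ∈ N_k`. -/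
theorem layeredIndep_card_le_and_card_eq_iff {α : Type*} [DecidableEq α] (k m : ℕ)
    (hk : 1 ≤ k) (hm : 1 ≤ m) (N : ℕ → Finset α)
    (hdisj : ∀ i ∈ Finset.Icc 1 k, ∀ j ∈ Finset.Icc 1 k, i ≠ j → Disjoint (N i) (N j))
    (hcard : ∀ i ∈ Finset.Icc 1 k, (N i).card = m)
    (u : ℕ → α) (hu : ∀ i ∈ Finset.Icc 1 (k - 1), u i ∈ N i)
    (S : Finset α) (hS : LayeredIndep k N u S) :
    S.card ≤ k ∧
      (S.card = k ↔ ∃ e ∈ N k, S = insert e ((Finset.Icc 1 (k - 1)).image u)) := by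
  obtain ⟨hsub, hind⟩ := hS
  set U := (Finset.Icc 1 (k - 1)).image u with hU
  have hmem {i : ℕ} (hi : i ∈ Finset.Icc 1 (k - 1)) : i ∈ Finset.Icc 1 k := by
    simp only [Finset.mem_Icc] at hi ⊢
    omega
  have hinj : Set.InjOn u (Finset.Icc 1 (k - 1) : Finset ℕ) :=
    injOn_of_mem_pairwise_disjoint (N := N)
      (fun i hi j hj => hdisj i (hmem hi) j (hmem hj)) (fun i hi => hu i hi)
  have hUcard : U.card = k - 1 := by simp [hU, Finset.card_image_of_injOn hinj]
  have hrest : (S \ U).card ≤ 1 := by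
    have := hind k (by simpa using hk)
    rwa [← Finset.inter_sdiff_assoc, Finset.inter_eq_left.2 hsub] at this
  have hsplit := Finset.card_sdiff_add_card_inter S U
  have hinter : (S ∩ U).card ≤ U.card := Finset.card_le_card Finset.inter_subset_right
  refine ⟨by omega, fun hSk => ?_, ?_⟩
  · have hUS : U ⊆ S :=
      Finset.inter_eq_right.1 (Finset.eq_of_subset_of_card_le Finset.inter_subset_right (by omega))
    obtain ⟨e, he⟩ := Finset.card_eq_one.1 (show (S \ U).card = 1 by omega)
    obtain ⟨heS, heU⟩ := Finset.mem_sdiff.1 (he ▸ Finset.mem_singleton_self e)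
    refine ⟨e, ?_, by rw [← Finset.sdiff_union_of_subset hUS, he, Finset.insert_eq]⟩
    obtain ⟨j, hj, hej⟩ := Finset.mem_biUnion.1 (hsub heS)
    obtain ⟨hj1, hjk⟩ := Finset.mem_Icc.1 hj
    rcases hjk.eq_or_lt with rfl | hlt
    · exact hej
    -- otherwise `e` and `u j` violate the `j`-th constraint
    have hj' : j ∈ Finset.Icc 1 (k - 1) := Finset.mem_Icc.2 ⟨hj1, by omega⟩
    have hjU : u j ∈ U := Finset.mem_image_of_mem u hj'
    have hjj : j ∈ Finset.Icc 1 j := Finset.mem_Icc.2 ⟨hj1, le_rfl⟩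
    refine absurd (Finset.card_le_one.1 (hind j hj) e ?_ (u j) ?_) fun h => heU (h ▸ hjU)
    · refine Finset.mem_inter.2 ⟨heS, Finset.mem_sdiff.2
        ⟨Finset.mem_biUnion.2 ⟨j, hjj, hej⟩, fun h => heU ?_⟩⟩
      exact Finset.image_subset_image (Finset.Icc_subset_Icc_right (by omega)) h
    · refine Finset.mem_inter.2 ⟨hUS hjU, Finset.mem_sdiff.2
        ⟨Finset.mem_biUnion.2 ⟨j, hjj, hu j hj'⟩, fun h => ?_⟩⟩
      obtain ⟨i, hi, hij⟩ := Finset.mem_image.1 h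
      rw [Finset.mem_Icc] at hi
      have := hinj (Finset.mem_coe.2 (Finset.mem_Icc.2 ⟨hi.1, by omega⟩)) hj' hij
      omega
  · rintro ⟨e, he, rfl⟩
    have heU : e ∉ U := by
      intro h
      obtain ⟨i, hi, rfl⟩ := Finset.mem_image.1 h
      have hik : i ≠ k := by
        rw [Finset.mem_Icc] at hi
        omega
      exact Finset.disjoint_left.1 (hdisj i (hmem hi) k (by simpa using hk) hik) (hu i hi) he
    rw [Finset.card_insert_of_notMem heU, hUcard]
    omega
end

section
/- With the layered partition-matroid construction, for every i ∈ {1,…,k} all elements of N_i are equivalent in the restricted family {S ∈ I : S ⊆ N_{≤i}}: for any two elements e_1, e_2 ∈ N_i and every set U ⊆ N_{≤i} with e_1 ∉ U and e_2 ∉ U, one has U ∪ {e_1} ∈ I if and only if U ∪ {e_2} ∈ I. -/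
/-- An element of `N i` is never one of the distinguished elements of the earlier layers. -/
theorem mem_layer_sdiff_image {α : Type*} [DecidableEq α] {k : ℕ} {N : ℕ → Finset α} {u : ℕ → α}
    (hdisj : ∀ i ∈ Finset.Icc 1 k, ∀ j ∈ Finset.Icc 1 k, i ≠ j → Disjoint (N i) (N j))
    (hu : ∀ i ∈ Finset.Icc 1 (k - 1), u i ∈ N i) {i : ℕ} (hi : i ∈ Finset.Icc 1 k)
    {e : α} (he : e ∈ N i) :
    e ∈ (Finset.Icc 1 i).biUnion N \ (Finset.Icc 1 (i - 1)).image u := by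
  rw [Finset.mem_Icc] at hi
  refine Finset.mem_sdiff.2 ⟨Finset.mem_biUnion.2 ⟨i, Finset.mem_Icc.2 ⟨hi.1, le_rfl⟩, he⟩, ?_⟩
  intro hmem
  obtain ⟨j, hj, rfl⟩ := Finset.mem_image.1 hmem
  rw [Finset.mem_Icc] at hj
  exact Finset.disjoint_left.1
    (hdisj i (Finset.mem_Icc.2 hi) j (Finset.mem_Icc.2 (by omega)) (by omega)) he
    (hu j (Finset.mem_Icc.2 (by omega)))

/-- If a subset `U` of the first `i` layers stays independent after adding an element of `N i`,
then `U` consists of distinguished elements of the earlier layers. -/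
theorem LayeredIndep.subset_image {α : Type*} [DecidableEq α] {k : ℕ} {N : ℕ → Finset α}
    {u : ℕ → α}
    (hdisj : ∀ i ∈ Finset.Icc 1 k, ∀ j ∈ Finset.Icc 1 k, i ≠ j → Disjoint (N i) (N j))
    (hu : ∀ i ∈ Finset.Icc 1 (k - 1), u i ∈ N i) {i : ℕ} (hi : i ∈ Finset.Icc 1 k)
    {e : α} (he : e ∈ N i) {U : Finset α} (hU : U ⊆ (Finset.Icc 1 i).biUnion N) (heU : e ∉ U)
    (h : LayeredIndep k N u (insert e U)) : U ⊆ (Finset.Icc 1 (i - 1)).image u := by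
  intro x hx
  by_contra hxu
  have hxe : x = e := Finset.card_le_one.1 (h.2 i hi)
    x (Finset.mem_inter.2 ⟨Finset.mem_insert_of_mem hx, Finset.mem_sdiff.2 ⟨hU hx, hxu⟩⟩)
    e (Finset.mem_inter.2 ⟨Finset.mem_insert_self e U, mem_layer_sdiff_image hdisj hu hi he⟩)
  exact heU (hxe ▸ hx)

/-- In an independent subset of the first `i` layers, an element of `N i` may be replaced by any
other element of `N i`. -/
theorem LayeredIndep.replace_of_mem_layer {α : Type*} [DecidableEq α] {k : ℕ} {N : ℕ → Finset α}
    {u : ℕ → α}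
    (hdisj : ∀ i ∈ Finset.Icc 1 k, ∀ j ∈ Finset.Icc 1 k, i ≠ j → Disjoint (N i) (N j))
    (hu : ∀ i ∈ Finset.Icc 1 (k - 1), u i ∈ N i) {i : ℕ} (hi : i ∈ Finset.Icc 1 k)
    {e e' : α} (he : e ∈ N i) (he' : e' ∈ N i) {U : Finset α}
    (hU : U ⊆ (Finset.Icc 1 i).biUnion N) (heU : e ∉ U)
    (h : LayeredIndep k N u (insert e U)) : LayeredIndep k N u (insert e' U) := by
  have hUu := h.subset_image hdisj hu hi he hU heU
  refine ⟨Finset.insert_subset (Finset.mem_biUnion.2 ⟨i, hi, he'⟩)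
    ((Finset.subset_insert e U).trans h.1), fun j hj => ?_⟩
  rcases lt_or_ge j i with hji | hij
  · refine (Finset.card_le_card fun x hx => ?_).trans (h.2 j hj)
    obtain ⟨hxU, hxj⟩ := Finset.mem_inter.1 hx
    refine Finset.mem_inter.2 ⟨?_, hxj⟩
    rcases Finset.mem_insert.1 hxU with rfl | hxU
    · obtain ⟨l, hl, hxl⟩ := Finset.mem_biUnion.1 (Finset.mem_sdiff.1 hxj).1
      rw [Finset.mem_Icc] at hl hj
      exact absurd hxl (Finset.disjoint_left.1
        (hdisj i hi l (Finset.mem_Icc.2 (by omega)) (by omega)) he')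
    · exact Finset.mem_insert_of_mem hxU
  · refine (Finset.card_le_card fun x hx => ?_).trans (Finset.card_singleton e').le
    obtain ⟨hxU, hxj⟩ := Finset.mem_inter.1 hx
    rcases Finset.mem_insert.1 hxU with rfl | hxU
    · exact Finset.mem_singleton_self x
    · exact absurd (Finset.image_subset_image (Finset.Icc_subset_Icc_right (by omega)) (hUu hxU))
        (Finset.mem_sdiff.1 hxj).2

/-- For every `i ∈ {1,…,k}`, all elements of `N_i` are equivalent in the restricted
family `{S ∈ I : S ⊆ N_{≤i}}`: for any `e₁, e₂ ∈ N_i` and any `U ⊆ N_{≤i}` with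
`e₁ ∉ U` and `e₂ ∉ U`, we have `U ∪ {e₁} ∈ I ↔ U ∪ {e₂} ∈ I`. -/
theorem layeredIndep_equivalent_elements {α : Type*} [DecidableEq α] (k m : ℕ)
    (hk : 1 ≤ k) (hm : 1 ≤ m) (N : ℕ → Finset α)
    (hdisj : ∀ i ∈ Finset.Icc 1 k, ∀ j ∈ Finset.Icc 1 k, i ≠ j → Disjoint (N i) (N j))
    (hcard : ∀ i ∈ Finset.Icc 1 k, (N i).card = m)
    (u : ℕ → α) (hu : ∀ i ∈ Finset.Icc 1 (k - 1), u i ∈ N i) :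
    ∀ i ∈ Finset.Icc 1 k, ∀ e₁ ∈ N i, ∀ e₂ ∈ N i,
      ∀ U ⊆ (Finset.Icc 1 i).biUnion N, e₁ ∉ U → e₂ ∉ U →
        (LayeredIndep k N u (insert e₁ U) ↔ LayeredIndep k N u (insert e₂ U)) := by
  intro i hi e₁ he₁ e₂ he₂ U hU h₁ h₂
  exact ⟨fun h => h.replace_of_mem_layer hdisj hu hi he₁ he₂ hU h₁,
    fun h => h.replace_of_mem_layer hdisj hu hi he₂ he₁ hU h₂⟩
end

section
/- Let g : 2^N → ℝ be a non-negative submodular function on a finite ground set N, let p ∈ [0, 1], and let A be a random subset of N (with any, possibly correlated, distribution) such that P(u ∈ A) ≤ p for every u ∈ N. Then E[g(A)] ≥ (1 − p) · g(∅). -/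
open MeasureTheory

section RandomFinset

variable {α Ω : Type*} [MeasurableSpace Ω] {N : Finset α} {A : Ω → Finset α}

theorem measurable_comp_of_random_subset {β : Type*} [MeasurableSpace β]
    (hAN : ∀ ω, A ω ⊆ N) (hmeas : ∀ s : Finset α, MeasurableSet {ω | A ω = s})
    (F : Finset α → β) : Measurable fun ω => F (A ω) := by
  intro T _
  have h : (fun ω => F (A ω)) ⁻¹' T =
      ⋃ s ∈ {s : Finset α | s ∈ N.powerset ∧ F s ∈ T}, {ω | A ω = s} := by
    ext ω
    simp [hAN ω]
  rw [h]
  exact MeasurableSet.biUnion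
    (N.powerset.finite_toSet.subset fun s hs => hs.1).countable fun s _ => hmeas s

theorem integrable_comp_of_random_subset (μ : Measure Ω) [IsFiniteMeasure μ]
    (hAN : ∀ ω, A ω ⊆ N) (hmeas : ∀ s : Finset α, MeasurableSet {ω | A ω = s})
    (F : Finset α → ℝ) : Integrable (fun ω => F (A ω)) μ := by
  refine Integrable.of_bound
    (measurable_comp_of_random_subset hAN hmeas F).aestronglyMeasurable
    (∑ s ∈ N.powerset, ‖F s‖) (ae_of_all _ fun ω => ?_)
  exact Finset.single_le_sum (f := fun s => ‖F s‖) (fun s _ => norm_nonneg _)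
    (Finset.mem_powerset.2 (hAN ω))

variable [DecidableEq α]

theorem integral_ite_mem_of_random_subset (μ : Measure Ω)
    (hAN : ∀ ω, A ω ⊆ N) (hmeas : ∀ s : Finset α, MeasurableSet {ω | A ω = s})
    (u : α) (c : ℝ) :
    ∫ ω, (if u ∈ A ω then c else 0) ∂μ = μ.real {ω | u ∈ A ω} * c := by
  have hu : MeasurableSet {ω | u ∈ A ω} :=
    measurableSet_setOfPred.2 (measurable_comp_of_random_subset hAN hmeas fun s => u ∈ s)
  rw [← smul_eq_mul, ← integral_indicator_const c hu]
  simp only [Set.indicator_apply, Set.mem_ofPred_eq]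

/-- If every element of `M` lies in `A` with probability in `[q, p]`, then
`E[g(A ∩ M)]` is at least `(1 - p) g(∅) + q g(M)`. -/
theorem le_integral_inter_of_random_subset (μ : Measure Ω) [IsProbabilityMeasure μ]
    (g : Finset α → ℝ) (hnn : ∀ s ⊆ N, 0 ≤ g s)
    (hsub : ∀ s ⊆ N, ∀ t ⊆ N, g (s ∪ t) + g (s ∩ t) ≤ g s + g t)
    (hAN : ∀ ω, A ω ⊆ N) (hmeas : ∀ s : Finset α, MeasurableSet {ω | A ω = s})
    (p : ℝ) (M : Finset α) (hMN : M ⊆ N) (hprob : ∀ u ∈ M, μ.real {ω | u ∈ A ω} ≤ p)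
    (q : ℝ) (hqp : q ≤ p) (hq : ∀ u ∈ M, q ≤ μ.real {ω | u ∈ A ω}) :
    (1 - p) * g ∅ + q * g M ≤ ∫ ω, g (A ω ∩ M) ∂μ := by
  induction M using Finset.induction_on_min_value (fun u => μ.real {ω | u ∈ A ω})
    generalizing q with
  | empty =>
    simp only [Finset.inter_empty, integral_const, probReal_univ, one_smul]
    nlinarith [hnn ∅ (Finset.empty_subset N)]
  | insert u M hu hmin ih =>
    have hM : M ⊆ N := (Finset.subset_insert u M).trans hMN
    have huM := Finset.mem_insert_self u M
    have ih' := ih hM (fun v hv => hprob v (Finset.mem_insert_of_mem hv))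
      (μ.real {ω | u ∈ A ω}) (hprob u huM) hmin
    have hpt (ω : Ω) : g (A ω ∩ M) + (if u ∈ A ω then g (insert u M) - g M else 0) ≤
        g (A ω ∩ insert u M) := by
      split_ifs with h
      · have hs := hsub (A ω ∩ insert u M) (Finset.inter_subset_left.trans (hAN ω)) M hM
        have h1 : A ω ∩ insert u M ∪ M = insert u M := by
          rw [Finset.inter_insert_of_mem h, Finset.insert_union,
            Finset.union_eq_right.2 Finset.inter_subset_right]
        have h2 : A ω ∩ insert u M ∩ M = A ω ∩ M := by
          rw [Finset.inter_assoc, Finset.inter_eq_right.2 (Finset.subset_insert u M)]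
        rw [h1, h2] at hs
        linarith
      · rw [Finset.inter_insert_of_notMem h, add_zero]
    have hint (F : Finset α → ℝ) := integrable_comp_of_random_subset μ hAN hmeas F
    have hle := integral_mono
      ((hint fun s => g (s ∩ M)).add (hint fun s => if u ∈ s then g (insert u M) - g M else 0))
      (hint fun s => g (s ∩ insert u M)) hpt
    simp only [Pi.add_apply] at hle
    rw [integral_add (hint fun s => g (s ∩ M))
      (hint fun s => if u ∈ s then g (insert u M) - g M else 0),
      integral_ite_mem_of_random_subset μ hAN hmeas] at hle
    nlinarith [mul_le_mul_of_nonneg_right (hq u huM) (hnn _ hMN)]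

end RandomFinset

/-- Let `g` be a non-negative submodular function on the subsets of a finite ground set
`N`, let `p ∈ [0,1]`, and let `A` be a random subset of `N` (with an arbitrary, possibly
correlated, distribution) such that `P(u ∈ A) ≤ p` for every `u ∈ N`. Then
`E[g(A)] ≥ (1 − p) · g(∅)`. -/
theorem expectation_ge_of_random_subset {α : Type*} [DecidableEq α]
    {Ω : Type*} [MeasurableSpace Ω] (μ : Measure Ω) [IsProbabilityMeasure μ]
    (N : Finset α) (g : Finset α → ℝ)
    (hnn : ∀ s ⊆ N, 0 ≤ g s)
    (hsub : ∀ s ⊆ N, ∀ t ⊆ N, g (s ∪ t) + g (s ∩ t) ≤ g s + g t)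
    (p : ℝ) (hp0 : 0 ≤ p) (hp1 : p ≤ 1)
    (A : Ω → Finset α) (hAN : ∀ ω, A ω ⊆ N)
    (hmeas : ∀ s : Finset α, MeasurableSet {ω | A ω = s})
    (hprob : ∀ u ∈ N, (μ {ω | u ∈ A ω}).toReal ≤ p) :
    (1 - p) * g ∅ ≤ ∫ ω, g (A ω) ∂μ := by
  have h := le_integral_inter_of_random_subset μ g hnn hsub hAN hmeas p N subset_rfl hprob
    0 hp0 fun _ _ => measureReal_nonneg
  simpa [Finset.inter_eq_left.2 (hAN _)] using h
end

section
/- Let f, g : 2^N → ℝ be set functions on a finite ground set N such that f is non-negative, monotone (f(A) ≤ f(B) whenever A ⊆ B) and submodular, and g is non-negative, down-monotone (g(A) ≥ g(B) whenever A ⊆ B) and submodular. Then the pointwise product h(S) = f(S) · g(S) is a non-negative submodular function. -/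
/-- If `f` is non-negative, monotone and submodular on the subsets of a finite ground set
`N`, and `g` is non-negative, down-monotone and submodular, then the pointwise product
`S ↦ f(S)·g(S)` is non-negative and submodular. -/
theorem product_submodular {α : Type*} [DecidableEq α] (N : Finset α)
    (f g : Finset α → ℝ)
    (hf0 : ∀ s ⊆ N, 0 ≤ f s)
    (hfmono : ∀ s t : Finset α, s ⊆ t → t ⊆ N → f s ≤ f t)
    (hfsub : ∀ s ⊆ N, ∀ t ⊆ N, f (s ∪ t) + f (s ∩ t) ≤ f s + f t)
    (hg0 : ∀ s ⊆ N, 0 ≤ g s)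
    (hgmono : ∀ s t : Finset α, s ⊆ t → t ⊆ N → g t ≤ g s)
    (hgsub : ∀ s ⊆ N, ∀ t ⊆ N, g (s ∪ t) + g (s ∩ t) ≤ g s + g t) :
    (∀ s ⊆ N, 0 ≤ f s * g s) ∧
      ∀ s ⊆ N, ∀ t ⊆ N,
        f (s ∪ t) * g (s ∪ t) + f (s ∩ t) * g (s ∩ t) ≤ f s * g s + f t * g t := by
  refine ⟨fun s hs ↦ mul_nonneg (hf0 s hs) (hg0 s hs), fun s hs t ht ↦ ?_⟩
  have hu : s ∪ t ⊆ N := Finset.union_subset hs ht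
  have hi : s ∩ t ⊆ N := Finset.inter_subset_left.trans hs
  have h_union := mul_nonneg (sub_nonneg.2 (hfsub s hs t ht)) (hg0 _ hu)
  have h_inter := mul_nonneg (hf0 _ hi) (sub_nonneg.2 (hgsub s hs t ht))
  have h_left := mul_nonneg (sub_nonneg.2 (hfmono (s ∩ t) s Finset.inter_subset_left hs))
    (sub_nonneg.2 (hgmono s (s ∪ t) Finset.subset_union_left hu))
  have h_right := mul_nonneg (sub_nonneg.2 (hfmono (s ∩ t) t Finset.inter_subset_right ht))
    (sub_nonneg.2 (hgmono t (s ∪ t) Finset.subset_union_right hu))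
  linarith
end

section
/- Let α > 1 be a real number and let h : ℕ → ℝ satisfy h(0) = 1 and h(k) = (1 − 1/(αk)) · h(k−1) + 1 for every integer k ≥ 1. Then h(k) ≤ (kα + α + 1)/(α + 1) for every k ≥ 0, and the inequality is strict for every k ≥ 1. -/
/-- Let `α > 1` and let `h : ℕ → ℝ` satisfy `h(0) = 1` and
`h(k) = (1 − 1/(αk))·h(k−1) + 1` for `k ≥ 1`. Then `h(k) ≤ (kα+α+1)/(α+1)` for every
`k ≥ 0`, with strict inequality for every `k ≥ 1`. -/
theorem recurrence_upper_bound (α : ℝ) (hα : 1 < α) (h : ℕ → ℝ) (h0 : h 0 = 1)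
    (hrec : ∀ k : ℕ, 1 ≤ k → h k = (1 - 1 / (α * (k : ℝ))) * h (k - 1) + 1) :
    (∀ k : ℕ, h k ≤ ((k : ℝ) * α + α + 1) / (α + 1)) ∧
      ∀ k : ℕ, 1 ≤ k → h k < ((k : ℝ) * α + α + 1) / (α + 1) := by
  have step : ∀ n : ℕ, h n ≤ ((n : ℝ) * α + α + 1) / (α + 1) →
      h (n + 1) < (((n + 1 : ℕ) : ℝ) * α + α + 1) / (α + 1) := by
    intro n hn
    have hα0 : 0 < α := by linarith
    have hn0 : (0 : ℝ) ≤ n := n.cast_nonneg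
    have hcoef : 0 ≤ 1 - 1 / (α * ((n : ℝ) + 1)) := by
      rw [sub_nonneg, div_le_one (by positivity)]
      nlinarith
    have hgap : (((n : ℝ) + 1) * α + α + 1) / (α + 1) -
        ((1 - 1 / (α * ((n : ℝ) + 1))) * (((n : ℝ) * α + α + 1) / (α + 1)) + 1) =
        1 / (α * ((n : ℝ) + 1) * (α + 1)) := by
      field_simp
      ring
    have hpos : 0 < 1 / (α * ((n : ℝ) + 1) * (α + 1)) := by positivity
    have hmul := mul_le_mul_of_nonneg_left hn hcoef
    rw [hrec (n + 1) (by omega), Nat.add_sub_cancel]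
    push_cast
    linarith
  have hle : ∀ k : ℕ, h k ≤ ((k : ℝ) * α + α + 1) / (α + 1) := by
    intro k
    induction k with
    | zero =>
      have hne : α + 1 ≠ 0 := by linarith
      simp [h0, div_self hne]
    | succ n ih => exact (step n ih).le
  refine ⟨hle, fun k hk => ?_⟩
  obtain ⟨n, rfl⟩ := Nat.exists_eq_add_of_le' hk
  exact step n (hle n)
end

section
/- Let α > 1 be a real number, p ≥ 1 an integer, and let x_1, …, x_p be reals with 0 ≤ x_i ≤ 1/α for every i. Define F_{p+1} = 0 and, for i = p down to 1, F_i = x_i + (1 − x_i/(p + 1 − i)) · F_{i+1}. Then F_1 < 1 + p/(α + 1). -/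
/-- One step of the recursion preserves the strict bound `1 + k / (α + 1)`. -/
theorem layered_step_lt {α y G k : ℝ} (hα : 1 < α) (hk : 0 ≤ k)
    (hy : y ≤ 1 / α) (hG : G < 1 + k / (α + 1)) :
    y + (1 - y / (k + 1)) * G < 1 + (k + 1) / (α + 1) := by
  have hα0 : 0 < α := by linarith
  have hyα : y * α ≤ 1 := (le_div_iff₀ hα0).mp hy
  have hy1 : y < 1 := hy.trans_lt ((div_lt_one hα0).mpr hα)
  have hcoef : 0 < 1 - y / (k + 1) := by
    rw [sub_pos, div_lt_one (by linarith)]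
    linarith
  have hgap : 1 + (k + 1) / (α + 1) - (y + (1 - y / (k + 1)) * (1 + k / (α + 1)))
      = (k * (1 - y * α) + 1) / ((k + 1) * (α + 1)) := by
    field_simp
    ring
  have hgap_nonneg : 0 ≤ (k * (1 - y * α) + 1) / ((k + 1) * (α + 1)) := by
    have : 0 ≤ 1 - y * α := by linarith
    positivity
  have := mul_lt_mul_of_pos_left hG hcoef
  linarith

/-- Let `α > 1`, `p ≥ 1`, and `x₁,…,x_p` reals with `0 ≤ x_i ≤ 1/α`. Define
`F_{p+1} = 0` and `F_i = x_i + (1 − x_i/(p+1−i))·F_{i+1}` for `i = p` down to `1`.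
Then `F₁ < 1 + p/(α+1)`. -/
theorem layered_recursion_strict_upper_bound (α : ℝ) (hα : 1 < α)
    (p : ℕ) (hp : 1 ≤ p)
    (x : ℕ → ℝ) (hx : ∀ i, 1 ≤ i → i ≤ p → 0 ≤ x i ∧ x i ≤ 1 / α)
    (F : ℕ → ℝ) (hF0 : F (p + 1) = 0)
    (hFrec : ∀ i, 1 ≤ i → i ≤ p →
      F i = x i + (1 - x i / ((p : ℝ) + 1 - (i : ℝ))) * F (i + 1)) :
    F 1 < 1 + (p : ℝ) / (α + 1) := by
  have key : ∀ k i : ℕ, 1 ≤ i → i + k = p + 1 → F i < 1 + (k : ℝ) / (α + 1) := by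
    intro k
    induction k with
    | zero =>
      intro i _ hik
      obtain rfl : i = p + 1 := by omega
      simp [hF0]
    | succ k ih =>
      intro i hi hik
      have hip : i ≤ p := by omega
      have hcast : (p : ℝ) + 1 - (i : ℝ) = (k : ℝ) + 1 := by
        have : (i : ℝ) + ((k : ℝ) + 1) = (p : ℝ) + 1 := by exact_mod_cast hik
        linarith
      rw [hFrec i hi hip, hcast, Nat.cast_succ]
      exact layered_step_lt hα k.cast_nonneg (hx i hi hip).2
        (ih (i + 1) (by omega) (by omega))
  exact key p 1 le_rfl (by omega)
end

section
/- Let M_1, …, M_k be matroids (k ≥ 1) on a common finite ground set N. If G ⊆ N is independent in every M_i and is inclusion-maximal among sets independent in all k matroids, then every set O ⊆ N that is independent in every M_i satisfies |O| ≤ k · |G|. In particular, the greedily constructed common independent set is a k-approximation to the maximum-cardinality common independent set. -/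
/-- If no element of the independent set `J` outside `I` can be added to `I`, then `J` has at most
as many elements as `I`. -/
theorem Matroid.Indep.encard_le_of_forall_not_indep_insert {α : Type*} {M : Matroid α}
    {I J : Set α} (hI : M.Indep I) (hJ : M.Indep J)
    (h : ∀ x ∈ J, x ∈ I ∨ ¬ M.Indep (insert x I)) : J.encard ≤ I.encard := by
  by_contra! hlt
  obtain ⟨x, hx, hxI⟩ := hI.augment hJ hlt
  exact (h x hx.1).elim hx.2 (fun hn ↦ hn hxI)

/-- Let `M₁,…,M_k` (`k ≥ 1`) be matroids on a common finite ground set `N`. If `G` is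
independent in every `Mᵢ` and is inclusion-maximal among common independent sets, then
every common independent set `O` satisfies `|O| ≤ k · |G|`. -/
theorem maximal_common_independent_approx {α : Type*} (k : ℕ) (hk : 1 ≤ k)
    (N : Set α) (hN : N.Finite)
    (M : Fin k → Matroid α) (hE : ∀ i, (M i).E = N)
    (G : Set α) (hGind : ∀ i, (M i).Indep G)
    (hGmax : ∀ G' : Set α, (∀ i, (M i).Indep G') → G ⊆ G' → G' = G)
    (O : Set α) (hOind : ∀ i, (M i).Indep O) :
    O.ncard ≤ k * G.ncard := by
  classical
  have hGfin : G.Finite := hN.subset (hE ⟨0, hk⟩ ▸ (hGind ⟨0, hk⟩).subset_ground)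
  have hOfin : O.Finite := hN.subset (hE ⟨0, hk⟩ ▸ (hOind ⟨0, hk⟩).subset_ground)
  let A : Fin k → Finset α := fun i ↦
    hOfin.toFinset.filter fun x ↦ x ∈ G ∨ ¬ (M i).Indep (insert x G)
  have mem_A : ∀ {i x}, x ∈ A i ↔ x ∈ O ∧ (x ∈ G ∨ ¬ (M i).Indep (insert x G)) := by simp [A]
  have hA : ∀ i, (A i).card ≤ G.ncard := fun i ↦ by
    have hle : (A i : Set α).encard ≤ G.encard :=
      (hGind i).encard_le_of_forall_not_indep_insert
        ((hOind i).subset fun _ hx ↦ (mem_A.1 hx).1) fun _ hx ↦ (mem_A.1 hx).2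
    rw [Set.encard_coe_eq_coe_finsetCard, ← hGfin.cast_ncard_eq] at hle
    exact_mod_cast hle
  have hcover : hOfin.toFinset ⊆ Finset.univ.biUnion A := fun x hx ↦ by
    by_contra hxA
    have hall : ∀ i, x ∉ G ∧ (M i).Indep (insert x G) := fun i ↦ by
      have hxi : x ∉ A i := fun h ↦ hxA (Finset.mem_biUnion.2 ⟨i, Finset.mem_univ i, h⟩)
      rw [mem_A] at hxi
      have hxO : x ∈ O := hOfin.mem_toFinset.1 hx
      tauto
    exact (hall ⟨0, hk⟩).1 <|
      hGmax _ (fun i ↦ (hall i).2) (Set.subset_insert x G) ▸ Set.mem_insert x G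
  calc O.ncard = hOfin.toFinset.card := Set.ncard_eq_toFinset_card O hOfin
    _ ≤ (Finset.univ.biUnion A).card := Finset.card_le_card hcover
    _ ≤ (Finset.univ : Finset (Fin k)).card * G.ncard :=
      Finset.card_biUnion_le_card_mul _ _ _ fun i _ ↦ hA i
    _ = k * G.ncard := by simp
end
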